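/- For any family 𝒴 of nonempty compact metric spaces, the following three conditions are equivalent: (1) there exists a nonempty compact metric space X such that for every Y ∈ 𝒴 there is a 1-Lipschitz surjection X → Y; (2) for every ε > 0 there exists a nonempty compact metric space X such that Y ≺_ε X for every Y ∈ 𝒴; (3) 𝒴 is GH-precompact. -/

import Mathlib

open GromovHausdorff Metric

/-- The first `N` terms of some sequence in `X` form an `r`-net of `X`. -/
def HasNet (X : Type*) [MetricSpace X] (N : ℕ) (r : ℝ) : Prop :=
  ∃ c : ℕ → X, ∀ x, ∃ k < N, dist x (c k) ≤ r

/-- `f` increases distances by at most `ε` and its image meets every closed ball of radius `δ`. -/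
def IsAlmostQuotient {X Y : Type*} [MetricSpace X] [MetricSpace Y] (f : X → Y) (ε δ : ℝ) : Prop :=
  (∀ x x', dist (f x) (f x') ≤ dist x x' + ε) ∧ ∀ y, ∃ x, dist y (f x) ≤ δ

theorem HasNet.mono {X : Type*} [MetricSpace X] {M N : ℕ} {r s : ℝ} (h : HasNet X M r)
    (hMN : M ≤ N) (hrs : r ≤ s) : HasNet X N s := by
  obtain ⟨c, hc⟩ := h
  refine ⟨c, fun x => ?_⟩
  obtain ⟨k, hk, hx⟩ := hc x
  exact ⟨k, hk.trans_le hMN, hx.trans hrs⟩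

theorem exists_hasNet (X : Type*) [MetricSpace X] [CompactSpace X] [Nonempty X] {r : ℝ}
    (hr : 0 < r) : ∃ N, HasNet X N r := by
  let c := TopologicalSpace.denseSeq X
  obtain ⟨t, ht⟩ := isCompact_univ.elim_finite_subcover (fun k => ball (c k) r)
    (fun _ => isOpen_ball) (fun x _ => by
      obtain ⟨k, hk⟩ := (TopologicalSpace.denseRange_denseSeq X).exists_dist_lt x hr
      exact Set.mem_iUnion.2 ⟨k, hk⟩)
  refine ⟨t.sup id + 1, c, fun x => ?_⟩
  obtain ⟨k, hk, hx⟩ := Set.mem_iUnion₂.1 (ht (Set.mem_univ x))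
  exact ⟨k, Nat.lt_succ_of_le (Finset.le_sup (f := id) hk), (mem_ball.1 hx).le⟩

namespace IsAlmostQuotient

variable {X Y : Type*} [MetricSpace X] [MetricSpace Y] {f : X → Y} {ε δ : ℝ}

theorem hasNet (hf : IsAlmostQuotient f ε δ) {N : ℕ} {r : ℝ} (h : HasNet X N r) :
    HasNet Y N (r + ε + δ) := by
  obtain ⟨c, hc⟩ := h
  refine ⟨f ∘ c, fun y => ?_⟩
  obtain ⟨x, hx⟩ := hf.2 y
  obtain ⟨k, hk, hxk⟩ := hc x
  refine ⟨k, hk, ?_⟩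
  have := dist_triangle y (f x) (f (c k))
  have := hf.1 x (c k)
  simp only [Function.comp_apply]
  linarith

theorem dist_le (hf : IsAlmostQuotient f ε δ) {D : ℝ} (h : ∀ x x' : X, dist x x' ≤ D)
    (y y' : Y) : dist y y' ≤ D + ε + 2 * δ := by
  obtain ⟨x, hx⟩ := hf.2 y
  obtain ⟨x', hx'⟩ := hf.2 y'
  have := dist_triangle4_right y y' (f x) (f x')
  have := hf.1 x x'
  have := h x x'
  linarith

end IsAlmostQuotient

theorem exists_isAlmostQuotient_of_ghDist_lt {X Y : Type*} [MetricSpace X] [CompactSpace X]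
    [Nonempty X] [MetricSpace Y] [CompactSpace Y] [Nonempty Y] {δ : ℝ} (h : ghDist X Y < δ) :
    ∃ f : X → Y, IsAlmostQuotient f (2 * δ) (2 * δ) := by
  obtain ⟨Φ, Ψ, hΦ, hΨ, hd⟩ := ghDist_eq_hausdorffDist X Y
  rw [hd] at h
  have fin : hausdorffEDist (Set.range Φ) (Set.range Ψ) ≠ ⊤ :=
    hausdorffEDist_ne_top_of_nonempty_of_bounded (Set.range_nonempty _) (Set.range_nonempty _)
      (isCompact_range hΦ.continuous).isBounded (isCompact_range hΨ.continuous).isBounded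
  have key (x : X) : ∃ y, dist (Φ x) (Ψ y) < δ := by
    obtain ⟨_, ⟨y, rfl⟩, hy⟩ := exists_dist_lt_of_hausdorffDist_lt (Set.mem_range_self x) h fin
    exact ⟨y, hy⟩
  choose f hf using key
  refine ⟨f, fun x x' => ?_, fun y => ?_⟩
  · rw [← hΨ.dist_eq, ← hΦ.dist_eq]
    have := dist_triangle4_left (Φ x) (Φ x') (Ψ (f x)) (Ψ (f x'))
    linarith [hf x, hf x']
  · obtain ⟨_, ⟨x, rfl⟩, hx⟩ := exists_dist_lt_of_hausdorffDist_lt' (Set.mem_range_self y) h fin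
    refine ⟨x, ?_⟩
    rw [← hΨ.dist_eq]
    have := dist_triangle_left (Ψ y) (Ψ (f x)) (Φ x)
    linarith [hf x]

theorem exists_dist_le_of_isBounded_range_toGHSpace {ι : Type*} (Y : ι → Type*)
    [∀ i, MetricSpace (Y i)] [∀ i, CompactSpace (Y i)] [∀ i, Nonempty (Y i)]
    (h : Bornology.IsBounded (Set.range fun i => toGHSpace (Y i))) :
    ∃ D : ℝ, ∀ i, ∀ y y' : Y i, dist y y' ≤ D := by
  obtain ⟨R, hR⟩ := h.subset_ball (default : GHSpace)
  refine ⟨diam (Set.univ : Set (default : GHSpace).Rep) + 2 * R + 2 * (2 * R), fun i => ?_⟩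
  have hi : ghDist (default : GHSpace).Rep (Y i) < R := by
    rw [ghDist, GHSpace.toGHSpace_rep, dist_comm]
    exact hR (Set.mem_range_self i)
  obtain ⟨f, hf⟩ := exists_isAlmostQuotient_of_ghDist_lt hi
  exact hf.dist_le fun x x' =>
    dist_le_diam_of_mem isCompact_univ.isBounded (Set.mem_univ x) (Set.mem_univ x')

theorem exists_hasNet_of_totallyBounded {ι : Type*} (Y : ι → Type*)
    [∀ i, MetricSpace (Y i)] [∀ i, CompactSpace (Y i)] [∀ i, Nonempty (Y i)]
    (h : TotallyBounded (Set.range fun i => toGHSpace (Y i))) {r : ℝ} (hr : 0 < r) :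
    ∃ N, ∀ i, HasNet (Y i) N r := by
  have hr5 : 0 < r / 5 := by positivity
  obtain ⟨t, ht, hcov⟩ := Metric.totallyBounded_iff.1 h (r / 5) hr5
  choose N hN using fun p : GHSpace => exists_hasNet p.Rep hr5
  refine ⟨ht.toFinset.sup N, fun i => ?_⟩
  obtain ⟨p, hp, hi⟩ := Set.mem_iUnion₂.1 (hcov (Set.mem_range_self i))
  have hd : ghDist p.Rep (Y i) < r / 5 := by
    rw [ghDist, GHSpace.toGHSpace_rep, dist_comm]
    exact hi
  obtain ⟨f, hf⟩ := exists_isAlmostQuotient_of_ghDist_lt hd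
  exact (hf.hasNet (hN p)).mono (Finset.le_sup (ht.mem_toFinset.2 hp)) (by linarith)

theorem totallyBounded_range_toGHSpace {ι : Type*} (Y : ι → Type*)
    [∀ i, MetricSpace (Y i)] [∀ i, CompactSpace (Y i)] [∀ i, Nonempty (Y i)] {D : ℝ}
    (hD : ∀ i, ∀ y y' : Y i, dist y y' ≤ D) (hN : ∀ r : ℝ, 0 < r → ∃ N, ∀ i, HasNet (Y i) N r) :
    TotallyBounded (Set.range fun i => toGHSpace (Y i)) := by
  have rep (i : ι) : Nonempty (Y i ≃ᵢ (toGHSpace (Y i)).Rep) :=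
    toGHSpace_eq_toGHSpace_iff_isometryEquiv.1 (GHSpace.toGHSpace_rep _).symm
  choose K hK using fun n : ℕ => hN ((1 / 2) ^ n) (by positivity)
  refine GromovHausdorff.totallyBounded (C := D) (u := fun n => 2 * (1 / 2) ^ n) (K := K) ?_ ?_ ?_
  · simpa using (tendsto_pow_atTop_nhds_zero_of_lt_one (r := (1 / 2 : ℝ)) (by norm_num)
      (by norm_num)).const_mul 2
  · rintro _ ⟨i, rfl⟩
    obtain ⟨e⟩ := rep i
    have y : Y i := Classical.arbitrary _
    refine diam_le_of_forall_dist_le (dist_nonneg.trans (hD i y y)) fun a _ b _ => ?_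
    rw [← e.symm.dist_eq]
    exact hD i _ _
  · rintro _ ⟨i, rfl⟩ n
    obtain ⟨e⟩ := rep i
    obtain ⟨c, hc⟩ := hK n i
    classical
    refine ⟨((Finset.range (K n)).image (e ∘ c) : Finset _), ?_, fun a _ => ?_⟩
    · refine Cardinal.mk_coe_finset.trans_le ?_
      exact_mod_cast Finset.card_image_le.trans (Finset.card_range _).le
    · obtain ⟨k, hk, hd⟩ := hc (e.symm a)
      refine Set.mem_iUnion₂.2 ⟨e (c k),
        Finset.mem_coe.2 (Finset.mem_image_of_mem _ (Finset.mem_range.2 hk)), ?_⟩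
      rw [mem_ball, ← e.symm.dist_eq, e.symm_apply_apply]
      have : (0 : ℝ) < (1 / 2) ^ n := by positivity
      linarith

theorem exists_compact_rescaling (X : Type*) [MetricSpace X] [CompactSpace X] [Nonempty X] {C : ℝ}
    (hC : 0 < C) :
    ∃ (Z : Type) (_ : MetricSpace Z) (_ : CompactSpace Z) (_ : Nonempty Z) (g : Z → X),
      Function.Surjective g ∧ ∀ a b, C * dist (g a) (g b) = dist a b := by
  let φ := fun x : X => C • kuratowskiEmbedding X x
  have hφ (x y : X) : dist (φ x) (φ y) = C * dist x y := by
    rw [dist_smul₀, (kuratowskiEmbedding.isometry X).dist_eq, Real.norm_of_nonneg hC.le]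
  have hcont : Continuous φ := (kuratowskiEmbedding.isometry X).continuous.const_smul C
  have hg (z : Set.range φ) : φ z.2.choose = z := z.2.choose_spec
  refine ⟨Set.range φ, inferInstance, isCompact_iff_compactSpace.1 (isCompact_range hcont),
    inferInstance, fun z => z.2.choose, fun x => ⟨⟨φ x, x, rfl⟩, ?_⟩, fun a b => ?_⟩
  · have h := hφ (Set.mem_range_self (f := φ) x).choose x
    rw [hg ⟨φ x, x, rfl⟩, dist_self] at h
    exact dist_eq_zero.1 ((mul_eq_zero.1 h.symm).resolve_left hC.ne')
  · rw [← hφ, hg, hg, Subtype.dist_eq]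

theorem exists_lipschitz_surjection_from_codes {Y : Type*} [MetricSpace Y] [CompactSpace Y]
    [Nonempty Y] {N : ℕ → ℕ} {C : ℝ} (hC : 1 ≤ C) (hD : ∀ y y' : Y, dist y y' ≤ C)
    (hN : ∀ n, HasNet Y (N n + 1) ((1 / 2) ^ (n + 2))) :
    ∃ f : (∀ n, Fin (N n + 1)) → Y, Function.Surjective f ∧
      ∀ x x', dist (f x) (f x') ≤ C * PiNat.dist.dist x x' := by
  let : MetricSpace (∀ n, Fin (N n + 1)) := PiNat.metricSpace
  choose c hc using hN
  let T : Set ((∀ n, Fin (N n + 1)) × Y) :=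
    {p | ∀ n, dist p.2 (c n (p.1 n)) ≤ (1 / 2) ^ (n + 2)}
  have hT : IsClosed T := by
    simp only [T, Set.ofPred_forall]
    refine isClosed_iInter fun n => isClosed_le (continuous_snd.dist ?_) continuous_const
    exact (continuous_of_discreteTopology (f := fun k : Fin (N n + 1) => c n k)).comp
      ((continuous_apply n).comp continuous_fst)
  have hS : IsClosed (Prod.fst '' T) := isClosedMap_fst_of_compactSpace _ hT
  have code (y : Y) : ∃ x, (x, y) ∈ T := by
    choose k hk hd using fun n => hc n y
    exact ⟨fun n => ⟨k n, hk n⟩, hd⟩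
  have close {x x' y y' n} (h : (x, y) ∈ T) (h' : (x', y') ∈ T) (hn : x n = x' n) :
      dist y y' ≤ (1 / 2) ^ (n + 1) := by
    have h1 : dist y (c n (x n)) ≤ (1 / 2) ^ (n + 2) := h n
    have h2 : dist y' (c n (x' n)) ≤ (1 / 2) ^ (n + 2) := h' n
    rw [← hn] at h2
    have := dist_triangle_right y y' (c n (x n))
    have : (1 / 2 : ℝ) ^ (n + 1) = (1 / 2) ^ (n + 2) + (1 / 2) ^ (n + 2) := by ring
    linarith
  have unique {x y y'} (h : (x, y) ∈ T) (h' : (x, y') ∈ T) : y = y' := by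
    refine dist_le_zero.1 (ge_of_tendsto' ((Filter.tendsto_add_atTop_iff_nat 1).2
      (tendsto_pow_atTop_nhds_zero_of_lt_one (r := (1 / 2 : ℝ)) (by norm_num) (by norm_num)))
      fun n => close h h' (n := n) rfl)
  obtain ⟨ρ, hρ, hrange, hlip⟩ := PiNat.exists_lipschitz_retraction_of_isClosed hS
    (by obtain ⟨x, hx⟩ := code (Classical.arbitrary Y); exact ⟨x, _, hx, rfl⟩)
  have decode (x) : ∃ y, (ρ x, y) ∈ T := by
    obtain ⟨⟨_, y⟩, hy, rfl⟩ : ρ x ∈ Prod.fst '' T := hrange ▸ Set.mem_range_self x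
    exact ⟨y, hy⟩
  choose f hf using decode
  refine ⟨f, fun y => ?_, fun x x' => ?_⟩
  · obtain ⟨x, hx⟩ := code y
    refine ⟨x, unique (hf x) ?_⟩
    rwa [hρ x ⟨_, hx, rfl⟩]
  · refine le_trans ?_ (mul_le_mul_of_nonneg_left (hlip.dist_le_mul x x' |>.trans_eq (one_mul _))
      (zero_le_one.trans hC))
    by_cases hne : ρ x = ρ x'
    · rw [unique (hf x) (hne ▸ hf x'), dist_self, hne, dist_self, mul_zero]
    · rw [PiNat.dist_eq_of_ne hne]
      rcases hm : PiNat.firstDiff (ρ x) (ρ x') with _ | m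
      · simpa using hD _ _
      · refine (close (hf x) (hf x') (PiNat.apply_eq_of_lt_firstDiff (n := m) (by omega))).trans ?_
        exact le_mul_of_one_le_left (by positivity) hC

theorem exists_common_lipschitz_cover {ι : Type*} (Y : ι → Type*)
    [∀ i, MetricSpace (Y i)] [∀ i, CompactSpace (Y i)] [∀ i, Nonempty (Y i)] {D : ℝ}
    (hD : ∀ i, ∀ y y' : Y i, dist y y' ≤ D) (hN : ∀ r : ℝ, 0 < r → ∃ N, ∀ i, HasNet (Y i) N r) :
    ∃ (X : Type) (_ : MetricSpace X) (_ : CompactSpace X) (_ : Nonempty X),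
      ∀ i, ∃ f : X → Y i, Function.Surjective f ∧ LipschitzWith 1 f := by
  choose N hN using fun n : ℕ => hN ((1 / 2) ^ (n + 2)) (by positivity)
  let : MetricSpace (∀ n, Fin (N n + 1)) := PiNat.metricSpace
  have hC : 1 ≤ max D 1 := le_max_right _ _
  obtain ⟨Z, mZ, cZ, nZ, g, hg, hdist⟩ :=
    exists_compact_rescaling (∀ n, Fin (N n + 1)) (zero_lt_one.trans_le hC)
  refine ⟨Z, mZ, cZ, nZ, fun i => ?_⟩
  obtain ⟨f, hf, hlip⟩ := exists_lipschitz_surjection_from_codes hC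
    (fun y y' => (hD i y y').trans (le_max_left _ _)) fun n => (hN n i).mono (Nat.le_succ _) le_rfl
  refine ⟨f ∘ g, hf.comp hg, LipschitzWith.of_dist_le_mul fun a b => ?_⟩
  rw [NNReal.coe_one, one_mul, ← hdist]
  exact hlip _ _

theorem totallyBounded_range_toGHSpace_of_almostQuotients {ι : Type*} (Y : ι → Type*)
    [∀ i, MetricSpace (Y i)] [∀ i, CompactSpace (Y i)] [∀ i, Nonempty (Y i)]
    (h : ∀ ε : ℝ, 0 < ε →
      ∃ (X : Type) (_ : MetricSpace X) (_ : CompactSpace X) (_ : Nonempty X),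
        ∀ i, ∃ f : X → Y i,
          (∀ x x' : X, dist (f x) (f x') ≤ dist x x' + ε) ∧
          ∀ y : Y i, infDist y (Set.range f) ≤ ε) :
    TotallyBounded (Set.range fun i => toGHSpace (Y i)) := by
  have h' (ε : ℝ) (hε : 0 < ε) :
      ∃ (X : Type) (_ : MetricSpace X) (_ : CompactSpace X) (_ : Nonempty X),
        ∀ i, ∃ f : X → Y i, IsAlmostQuotient f ε (2 * ε) := by
    obtain ⟨X, mX, cX, nX, hX⟩ := h ε hε
    refine ⟨X, mX, cX, nX, fun i => ?_⟩
    obtain ⟨f, hf, hdense⟩ := hX i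
    refine ⟨f, hf, fun y => ?_⟩
    obtain ⟨_, ⟨x, rfl⟩, hx⟩ := (infDist_lt_iff (Set.range_nonempty f)).1
      ((hdense y).trans_lt (by linarith : ε < 2 * ε))
    exact ⟨x, hx.le⟩
  obtain ⟨X, _, _, _, hX⟩ := h' 1 one_pos
  refine totallyBounded_range_toGHSpace Y
    (D := diam (Set.univ : Set X) + 1 + 2 * (2 * 1)) (fun i => ?_) fun r hr => ?_
  · obtain ⟨f, hf⟩ := hX i
    exact hf.dist_le fun x x' =>
      dist_le_diam_of_mem isCompact_univ.isBounded (Set.mem_univ x) (Set.mem_univ x')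
  · have hr4 : 0 < r / 4 := by positivity
    obtain ⟨X, _, _, _, hX⟩ := h' (r / 4) hr4
    obtain ⟨N, hN⟩ := exists_hasNet X hr4
    refine ⟨N, fun i => ?_⟩
    obtain ⟨f, hf⟩ := hX i
    exact (hf.hasNet hN).mono le_rfl (by linarith)

open GromovHausdorff Metric

/-- For a family `𝒴` of nonempty compact metric spaces, the following
are equivalent: (1) some nonempty compact metric space admits a `1`-Lipschitz
surjection onto every member of `𝒴`; (2) for every `ε > 0` some nonempty compact
metric space `X` satisfies `Y ≺_ε X` for all `Y ∈ 𝒴`; (3) `𝒴` is GH-precompact.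
We state this as (1) ↔ (3) together with (2) ↔ (3). -/
theorem stmt7 {ι : Type*} (Y : ι → Type*) [∀ i, MetricSpace (Y i)]
    [∀ i, CompactSpace (Y i)] [∀ i, Nonempty (Y i)] :
    ((∃ (X : Type) (_ : MetricSpace X) (_ : CompactSpace X) (_ : Nonempty X),
        ∀ i, ∃ f : X → Y i, Function.Surjective f ∧ LipschitzWith 1 f) ↔
      TotallyBounded (Set.range fun i => toGHSpace (Y i))) ∧
    ((∀ ε : ℝ, 0 < ε →
        ∃ (X : Type) (_ : MetricSpace X) (_ : CompactSpace X) (_ : Nonempty X),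
          ∀ i, ∃ f : X → Y i,
            (∀ x x' : X, dist (f x) (f x') ≤ dist x x' + ε) ∧
            ∀ y : Y i, infDist y (Set.range f) ≤ ε) ↔
      TotallyBounded (Set.range fun i => toGHSpace (Y i))) := by
  have cover_of_totallyBounded (h : TotallyBounded (Set.range fun i => toGHSpace (Y i))) :=
    let ⟨_, hD⟩ := exists_dist_le_of_isBounded_range_toGHSpace Y h.isBounded
    exists_common_lipschitz_cover Y hD fun _ => exists_hasNet_of_totallyBounded Y h
  have almost_of_cover : (∃ (X : Type) (_ : MetricSpace X) (_ : CompactSpace X) (_ : Nonempty X),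
      ∀ i, ∃ f : X → Y i, Function.Surjective f ∧ LipschitzWith 1 f) → ∀ ε : ℝ, 0 < ε →
        ∃ (X : Type) (_ : MetricSpace X) (_ : CompactSpace X) (_ : Nonempty X),
          ∀ i, ∃ f : X → Y i,
            (∀ x x' : X, dist (f x) (f x') ≤ dist x x' + ε) ∧
            ∀ y : Y i, infDist y (Set.range f) ≤ ε := by
    rintro ⟨X, mX, cX, nX, hX⟩ ε hε
    refine ⟨X, mX, cX, nX, fun i => ?_⟩
    obtain ⟨f, hf, hlip⟩ := hX i
    refine ⟨f, fun x x' => ?_, fun y => ?_⟩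
    · have := hlip.dist_le_mul x x'
      rw [NNReal.coe_one, one_mul] at this
      linarith
    · rw [infDist_zero_of_mem (Set.mem_range.2 (hf y))]
      exact hε.le
  have totallyBounded_of_almost := totallyBounded_range_toGHSpace_of_almostQuotients Y
  exact ⟨⟨fun h => totallyBounded_of_almost (almost_of_cover h), cover_of_totallyBounded⟩,
    totallyBounded_of_almost, fun h => almost_of_cover (cover_of_totallyBounded h)⟩
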